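/- arXiv:1905.08464 — 8 statements merged into one kernel-verified Lean document; each statement's English description precedes it below -/
import Mathlib

section
/- Let m, m' ∈ ℝ and ν, ν', α, α', β, β' > 0. The Kullback–Leibler divergence from the normal–gamma distribution with parameters (m',ν',α',β') to the normal–gamma distribution with parameters (m,ν,α,β), i.e., KL(p(·,· | m',ν',α',β') ‖ p(·,· | m,ν,α,β)) = ∫∫ p(μ,τ | m',ν',α',β') · ln( p(μ,τ | m',ν',α',β') / p(μ,τ | m,ν,α,β) ) dμ dτ, equals K(m,ν,α,β) := α'(m−m')²ν/(2β') + ν/(2ν') − (1/2)ln(ν/ν') − 1/2 − α·ln(β/β') + ln(Γ(α)/Γ(α')) − (α−α')Ψ(α') + α'(β−β')/β', where Ψ(α) = Γ'(α)/Γ(α) is the digamma function. -/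
/-- The digamma function `Ψ(α) = Γ'(α)/Γ(α)`. -/
noncomputable def digamma (x : ℝ) : ℝ := deriv Real.Gamma x / Real.Gamma x

/-- The normal–gamma density with parameters `m ν α β`, evaluated at `(μ, τ)`. -/
noncomputable def normalGammaPDF (m ν α β : ℝ) (μ τ : ℝ) : ℝ :=
  (β ^ α * Real.sqrt ν) / (Real.Gamma α * Real.sqrt (2 * Real.pi)) *
    τ ^ (α - 1 / 2) * Real.exp (-(β * τ)) * Real.exp (-(ν * τ * (μ - m) ^ 2) / 2)

open Real MeasureTheory ProbabilityTheory Set Filter Topology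

theorem integrableOn_rpow_mul_exp_neg_mul_Ioi {a b : ℝ} (ha : 0 < a) (hb : 0 < b) :
    IntegrableOn (fun t : ℝ => t ^ (a - 1) * exp (-(b * t))) (Ioi 0) := by
  simpa using integrableOn_rpow_mul_exp_neg_mul_rpow (s := a - 1) (by linarith) one_pos hb

theorem mellin_ofReal_re {f : ℝ → ℝ} (x : ℝ) (hf : MellinConvergent (fun t => (f t : ℂ)) x) :
    IntegrableOn (fun t : ℝ => t ^ (x - 1) * f t) (Ioi 0) ∧
      (mellin (fun t => (f t : ℂ)) x).re = ∫ t in Ioi (0 : ℝ), t ^ (x - 1) * f t := by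
  have key : EqOn (fun t : ℝ => (t : ℂ) ^ ((x : ℂ) - 1) • (f t : ℂ))
      (fun t : ℝ => ((t ^ (x - 1) * f t : ℝ) : ℂ)) (Ioi 0) := by
    intro t ht
    have ht : (0 : ℝ) < t := ht
    simp only [smul_eq_mul, Complex.ofReal_mul, Complex.ofReal_cpow ht.le, Complex.ofReal_sub,
      Complex.ofReal_one]
  have hint := (integrableOn_congr_fun key measurableSet_Ioi).1 hf
  refine ⟨Integrable.re hint, ?_⟩
  rw [mellin, setIntegral_congr_fun measurableSet_Ioi key, integral_complex_ofReal,
    Complex.ofReal_re]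

theorem integral_log_mul_rpow_mul_exp_neg_mul_Ioi {a b : ℝ} (ha : 0 < a) (hb : 0 < b) :
    IntegrableOn (fun t : ℝ => t ^ (a - 1) * (log t * exp (-(b * t)))) (Ioi 0) ∧
      ∫ t in Ioi (0 : ℝ), t ^ (a - 1) * (log t * exp (-(b * t))) =
        (1 / b) ^ a * (deriv Gamma a - log b * Gamma a) := by
  have hcont : Continuous fun t : ℝ => ((exp (-(b * t)) : ℝ) : ℂ) := by fun_prop
  have htop : (fun t : ℝ => ((exp (-(b * t)) : ℝ) : ℂ)) =O[atTop] (· ^ (-(a + 1))) := by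
    rw [← Asymptotics.isBigO_norm_left]
    simp_rw [Complex.norm_real, Asymptotics.isBigO_norm_left]
    simpa only [neg_mul] using (isLittleO_exp_neg_mul_rpow_atTop hb (-(a + 1))).isBigO
  have hbot : (fun t : ℝ => ((exp (-(b * t)) : ℝ) : ℂ)) =O[𝓝[>] 0] (· ^ (-(0 : ℝ))) := by
    simp_rw [neg_zero, rpow_zero]
    exact Asymptotics.isBigO_const_of_tendsto hcont.continuousWithinAt (by simp)
  have hloc := hcont.continuousOn.locallyIntegrableOn (μ := volume)
    (measurableSet_Ioi (a := (0 : ℝ)))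
  obtain ⟨hconv, hderiv⟩ := mellin_hasDerivAt_of_isBigO_rpow (s := (a : ℂ)) hloc htop
    (by simp) hbot (by simpa using ha)
  have hlog : (fun t : ℝ => log t • ((exp (-(b * t)) : ℝ) : ℂ)) =
      fun t => ((log t * exp (-(b * t)) : ℝ) : ℂ) := by
    ext t; simp
  rw [hlog] at hconv hderiv
  obtain ⟨hint, hre⟩ := mellin_ofReal_re a hconv
  refine ⟨hint, ?_⟩
  rw [← hre]
  refine hderiv.real_of_complex.unique ?_
  have hev : (fun x : ℝ => (mellin (fun t : ℝ => ((exp (-(b * t)) : ℝ) : ℂ)) x).re) =ᶠ[𝓝 a]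
      fun x => (1 / b) ^ x * Gamma x := by
    filter_upwards [eventually_gt_nhds ha, eventually_lt_nhds (lt_add_one a)] with x hx hx'
    rw [(mellin_ofReal_re x (mellinConvergent_of_isBigO_rpow hloc htop (by simpa using hx') hbot
      (by simpa using hx))).2, integral_rpow_mul_exp_neg_mul_Ioi hx hb]
  refine HasDerivAt.congr_of_eventuallyEq ?_ hev
  have hG : HasDerivAt Gamma (deriv Gamma a) a :=
    (differentiableAt_Gamma fun m => (ha.trans_le' (by simp)).ne').hasDerivAt
  convert! ((hasDerivAt_id a).const_rpow (a := 1 / b) (by positivity)).mul hG using 1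
  simp only [id_eq, one_div, log_inv]
  ring

theorem integral_sub_sq_gaussianReal (m a : ℝ) (v : NNReal) :
    Integrable (fun x => (x - a) ^ 2) (gaussianReal m v) ∧
      ∫ x, (x - a) ^ 2 ∂gaussianReal m v = v + (m - a) ^ 2 := by
  have hL : MemLp (fun x : ℝ => x - a) 2 (gaussianReal m v) :=
    (memLp_id_gaussianReal 2).sub (memLp_const a)
  refine ⟨hL.integrable_sq, ?_⟩
  have hid : Integrable (fun x : ℝ => x) (gaussianReal m v) :=
    (memLp_id_gaussianReal 1).integrable (by simp)
  have hvar := variance_eq_sub hL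
  rw [variance_sub_const (by fun_prop), variance_fun_id_gaussianReal,
    integral_sub hid (integrable_const a), integral_id_gaussianReal] at hvar
  simp only [integral_const, probReal_univ, one_smul, Pi.pow_apply] at hvar
  linarith

theorem normalGammaPDF_eq_mul_gaussianPDFReal {m ν α β τ : ℝ} (hν : 0 < ν) (hτ : 0 < τ) (μ : ℝ) :
    normalGammaPDF m ν α β μ τ =
      β ^ α / Gamma α * (τ ^ (α - 1) * exp (-(β * τ))) *
        gaussianPDFReal m (1 / (ν * τ)).toNNReal μ := by
  have hv : 0 ≤ 1 / (ν * τ) := by positivity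
  rw [normalGammaPDF, gaussianPDFReal, Real.coe_toNNReal _ hv]
  have h1 : τ ^ (α - 1 / 2) = τ ^ (α - 1) * √τ := by
    rw [sqrt_eq_rpow, ← rpow_add hτ]; ring_nf
  have h2 : √(2 * π * (1 / (ν * τ))) = √(2 * π) / (√ν * √τ) := by
    rw [mul_one_div, sqrt_div (by positivity), sqrt_mul hν.le]
  have h3 : -(μ - m) ^ 2 / (2 * (1 / (ν * τ))) = -(ν * τ * (μ - m) ^ 2) / 2 := by
    field_simp
  rw [h1, h2, h3, inv_div]
  ring

theorem log_normalGammaPDF {m ν α β τ : ℝ} (hν : 0 < ν) (hα : 0 < α) (hβ : 0 < β) (hτ : 0 < τ)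
    (μ : ℝ) :
    log (normalGammaPDF m ν α β μ τ) =
      α * log β + log ν / 2 - log (Gamma α) - log √(2 * π) + (α - 1 / 2) * log τ - β * τ
        - ν * τ * (μ - m) ^ 2 / 2 := by
  have hΓ := Gamma_pos_of_pos hα
  rw [normalGammaPDF, log_mul (by positivity) (by positivity),
    log_mul (by positivity) (by positivity), log_mul (by positivity) (by positivity),
    log_div (by positivity) (by positivity), log_mul (by positivity) (by positivity),
    log_mul (by positivity) (by positivity), log_exp, log_exp, log_rpow hβ, log_rpow hτ,
    log_sqrt hν.le]
  ring

theorem normalGammaPDF_pos {m ν α β τ : ℝ} (hν : 0 < ν) (hα : 0 < α) (hβ : 0 < β) (hτ : 0 < τ)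
    (μ : ℝ) : 0 < normalGammaPDF m ν α β μ τ := by
  have hΓ := Gamma_pos_of_pos hα
  unfold normalGammaPDF
  positivity

/-- The divergence integrand integrated over the location variable at a fixed precision. -/
theorem integral_normalGammaPDF_mul_log_div {m m' ν ν' α α' β β' τ : ℝ}
    (hν : 0 < ν) (hν' : 0 < ν') (hα : 0 < α) (hα' : 0 < α') (hβ : 0 < β) (hβ' : 0 < β')
    (hτ : 0 < τ) :
    ∫ μ : ℝ, normalGammaPDF m' ν' α' β' μ τ *
        log (normalGammaPDF m' ν' α' β' μ τ / normalGammaPDF m ν α β μ τ) =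
      β' ^ α' / Gamma α' * (τ ^ (α' - 1) * exp (-(β' * τ))) *
        (α' * log β' - α * log β + (log ν' - log ν) / 2 - (log (Gamma α') - log (Gamma α))
          - 1 / 2 + ν / (2 * ν') + (α' - α) * log τ
          + (β - β' + ν * (m - m') ^ 2 / 2) * τ) := by
  set v : NNReal := (1 / (ν' * τ)).toNNReal with hv
  have hvpos : 0 < 1 / (ν' * τ) := by positivity
  have hvne : v ≠ 0 := (Real.toNNReal_pos.2 hvpos).ne'
  have hvcoe : (v : ℝ) = 1 / (ν' * τ) := Real.coe_toNNReal _ hvpos.le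
  set c : ℝ := α' * log β' - α * log β + (log ν' - log ν) / 2 - (log (Gamma α') - log (Gamma α))
    + (α' - α) * log τ + (β - β') * τ with hc
  have hlog (μ : ℝ) : normalGammaPDF m' ν' α' β' μ τ *
      log (normalGammaPDF m' ν' α' β' μ τ / normalGammaPDF m ν α β μ τ) =
      β' ^ α' / Gamma α' * (τ ^ (α' - 1) * exp (-(β' * τ))) * (gaussianPDFReal m' v μ •
        (c - ν' * τ / 2 * (μ - m') ^ 2 + ν * τ / 2 * (μ - m) ^ 2)) := by
    rw [log_div (normalGammaPDF_pos hν' hα' hβ' hτ μ).ne' (normalGammaPDF_pos hν hα hβ hτ μ).ne',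
      log_normalGammaPDF hν' hα' hβ' hτ, log_normalGammaPDF hν hα hβ hτ,
      normalGammaPDF_eq_mul_gaussianPDFReal hν' hτ, smul_eq_mul, mul_assoc _ (gaussianPDFReal _ _ _)]
    congr 2
    rw [hc]
    ring
  obtain ⟨hi', he'⟩ := integral_sub_sq_gaussianReal m' m' v
  obtain ⟨hi, he⟩ := integral_sub_sq_gaussianReal m' m v
  have hsub : Integrable (fun x => c - ν' * τ / 2 * (x - m') ^ 2) (gaussianReal m' v) :=
    (integrable_const c).sub (hi'.const_mul _)
  simp_rw [hlog]
  rw [integral_const_mul, ← integral_gaussianReal_eq_integral_smul hvne,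
    integral_add hsub (hi.const_mul _),
    integral_sub (integrable_const c) (hi'.const_mul _), integral_const_mul, integral_const_mul,
    he, he', hvcoe]
  simp only [integral_const, probReal_univ, one_smul]
  congr 1
  rw [hc]
  field_simp
  ring

/-- The Kullback–Leibler divergence from the normal–gamma distribution with parameters
`(m', ν', α', β')` to the one with parameters `(m, ν, α, β)` equals the explicit expression
`K(m, ν, α, β)` of the GCP approach. -/
theorem normalGamma_KL_divergence
    (m m' ν ν' α α' β β' : ℝ)
    (hν : 0 < ν) (hν' : 0 < ν') (hα : 0 < α) (hα' : 0 < α')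
    (hβ : 0 < β) (hβ' : 0 < β') :
    (∫ τ in Set.Ioi (0 : ℝ), ∫ μ : ℝ,
        normalGammaPDF m' ν' α' β' μ τ *
          Real.log (normalGammaPDF m' ν' α' β' μ τ / normalGammaPDF m ν α β μ τ)) =
      α' * (m - m') ^ 2 * ν / (2 * β') + ν / (2 * ν') - (1 / 2) * Real.log (ν / ν')
        - 1 / 2 - α * Real.log (β / β') + Real.log (Real.Gamma α / Real.Gamma α')
        - (α - α') * digamma α' + α' * (β - β') / β' := by
  have hΓ := Gamma_pos_of_pos hα
  have hΓ' := Gamma_pos_of_pos hα'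
  set A : ℝ := α' * log β' - α * log β + (log ν' - log ν) / 2
    - (log (Gamma α') - log (Gamma α)) - 1 / 2 + ν / (2 * ν') with hA
  set B : ℝ := β - β' + ν * (m - m') ^ 2 / 2 with hB
  have hinner : EqOn (fun τ : ℝ => ∫ μ : ℝ, normalGammaPDF m' ν' α' β' μ τ *
        log (normalGammaPDF m' ν' α' β' μ τ / normalGammaPDF m ν α β μ τ))
      (fun τ => β' ^ α' / Gamma α' * (A * (τ ^ (α' - 1) * exp (-(β' * τ)))
        + (α' - α) * (τ ^ (α' - 1) * (log τ * exp (-(β' * τ))))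
        + B * (τ ^ (α' + 1 - 1) * exp (-(β' * τ))))) (Ioi 0) := by
    intro τ hτ
    have hτ : (0 : ℝ) < τ := hτ
    have hpow : τ ^ (α' + 1 - 1) = τ ^ (α' - 1) * τ := by
      rw [← rpow_add_one hτ.ne']; ring_nf
    simp only [integral_normalGammaPDF_mul_log_div hν hν' hα hα' hβ hβ' hτ, hpow, hA, hB]
    ring
  have hα1 : 0 < α' + 1 := by positivity
  have h0 := integrableOn_rpow_mul_exp_neg_mul_Ioi hα' hβ'
  have h1 := integrableOn_rpow_mul_exp_neg_mul_Ioi hα1 hβ'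
  obtain ⟨hl, hle⟩ := integral_log_mul_rpow_mul_exp_neg_mul_Ioi hα' hβ'
  rw [setIntegral_congr_fun measurableSet_Ioi hinner, integral_const_mul,
    integral_add ((h0.const_mul A).fun_add (hl.const_mul _)) (h1.const_mul B),
    integral_add (h0.const_mul A) (hl.const_mul _), integral_const_mul, integral_const_mul,
    integral_const_mul, hle, integral_rpow_mul_exp_neg_mul_Ioi hα' hβ',
    integral_rpow_mul_exp_neg_mul_Ioi hα1 hβ', Gamma_add_one hα'.ne',
    rpow_add_one (by positivity), one_div β', inv_rpow hβ'.le, digamma, log_div hν.ne' hν'.ne',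
    log_div hβ.ne' hβ'.ne', log_div hΓ.ne' hΓ'.ne', hA, hB]
  have hpow : 0 < β' ^ α' := by positivity
  field_simp
  ring
end

section
/- Fix ν, α, β > 0 and y ∈ ℝ, and set m' = (νm̂ + y)/(ν+1), ν' = ν+1, α' = α+1/2, β' = β + (ν/(ν+1))·(y−m̂)²/2 evaluated at a point m̂ ∈ ℝ, held fixed. Define K(m) := α'(m−m')²ν/(2β') + ν/(2ν') − (1/2)ln(ν/ν') − 1/2 − α·ln(β/β') + ln(Γ(α)/Γ(α')) − (α−α')Ψ(α') + α'(β−β')/β' as a function of m only. Then, with z := y − m̂ and σ := β(ν+1)/ν, the negative derivative of K with respect to m evaluated at m = m̂ equals (2α+1)·z/(2σ + z²). -/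
/-- The negative gradient of the KL divergence `K` with respect to `m`, with the posterior
parameters `m', ν', α', β'` held fixed at their values computed from the current point `m̂`,
equals `(2α+1)·z/(2σ + z²)`, where `z = y − m̂` and `σ = β(ν+1)/ν`. -/
theorem gcp_neg_grad_m
    (ν α β y mhat : ℝ) (hν : 0 < ν) (hα : 0 < α) (hβ : 0 < β)
    (m' ν' α' β' z σ : ℝ)
    (hm' : m' = (ν * mhat + y) / (ν + 1))
    (hν' : ν' = ν + 1)
    (hα' : α' = α + 1 / 2)
    (hβ' : β' = β + (ν / (ν + 1)) * (y - mhat) ^ 2 / 2)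
    (hz : z = y - mhat)
    (hσ : σ = β * (ν + 1) / ν) :
    -deriv (fun m : ℝ =>
        α' * (m - m') ^ 2 * ν / (2 * β') + ν / (2 * ν') - (1 / 2) * Real.log (ν / ν')
          - 1 / 2 - α * Real.log (β / β') + Real.log (Real.Gamma α / Real.Gamma α')
          - (α - α') * digamma α' + α' * (β - β') / β') mhat
      = (2 * α + 1) * z / (2 * σ + z ^ 2) := by
  have hderiv : HasDerivAt (fun m : ℝ =>
        α' * (m - m') ^ 2 * ν / (2 * β') + ν / (2 * ν') - (1 / 2) * Real.log (ν / ν')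
          - 1 / 2 - α * Real.log (β / β') + Real.log (Real.Gamma α / Real.Gamma α')
          - (α - α') * digamma α' + α' * (β - β') / β')
      (α' * (2 * (mhat - m')) * ν / (2 * β')) mhat := by
    have hsq : HasDerivAt (fun m : ℝ => (m - m') ^ 2) (2 * (mhat - m')) mhat := by
      simpa using ((hasDerivAt_id mhat).sub_const m').fun_pow 2
    exact ((((((((hsq.const_mul α').mul_const ν).div_const (2 * β')).add_const _).sub_const
      _).sub_const _).sub_const _).add_const _).sub_const _ |>.add_const _
  have hβ'_pos : 0 < β' := by rw [hβ']; positivity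
  have hσ_pos : 0 < σ := by rw [hσ]; positivity
  have hden : 2 * (ν + 1) * β' = ν * (2 * σ + z ^ 2) := by
    rw [hβ', hσ, hz]
    field_simp
  have hdiff : (ν + 1) * (mhat - m') = -z := by
    rw [hm', hz]
    field_simp
    ring
  rw [hderiv.deriv, ← neg_div, div_eq_div_iff (by positivity) (by positivity), hα']
  apply mul_left_cancel₀ (show ν + 1 ≠ 0 by positivity)
  linear_combination (-(2 * α + 1) * ν * (2 * σ + z ^ 2)) * hdiff - (2 * α + 1) * z * hden
end

section
/- Fix m, ν, β > 0 (m ∈ ℝ) and y ∈ ℝ, set z := y − m, σ := β(ν+1)/ν, and let m' = (νm + y)/(ν+1), ν' = ν+1, α' = α̂+1/2, β' = β + (ν/(ν+1))z²/2 evaluated at a point α̂ > 0, held fixed. Define K(α) := α'(m−m')²ν/(2β') + ν/(2ν') − (1/2)ln(ν/ν') − 1/2 − α·ln(β/β') + ln(Γ(α)/Γ(α')) − (α−α')Ψ(α') + α'(β−β')/β' as a function of α only. Then the negative derivative of K with respect to α evaluated at α = α̂ equals −[ ln(1 + z²/(2σ)) + Ψ(α̂) − Ψ(α̂ + 1/2)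 ]. -/
theorem hasDerivAt_log_Gamma_div {x : ℝ} (hx : 0 < x) {c : ℝ} (hc : c ≠ 0) :
    HasDerivAt (fun t : ℝ => Real.log (Real.Gamma t / c)) (digamma x) x := by
  have hΓ : Real.Gamma x ≠ 0 := (Real.Gamma_pos_of_pos hx).ne'
  have hdiff : DifferentiableAt ℝ Real.Gamma x :=
    Real.differentiableAt_Gamma fun n => by
      have : (0 : ℝ) ≤ n := n.cast_nonneg
      linarith
  convert (hdiff.hasDerivAt.div_const c).log (div_ne_zero hΓ hc) using 1
  rw [digamma]
  field_simp

/-- The negative gradient of the KL divergence `K` with respect to `α`, with the posterior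
parameters `m', ν', α', β'` held fixed at their values computed from the current point `α̂`,
equals `−[ln(1 + z²/(2σ)) + Ψ(α̂) − Ψ(α̂ + 1/2)]`, where `z = y − m` and `σ = β(ν+1)/ν`. -/
theorem gcp_neg_grad_alpha
    (m ν β y αhat : ℝ) (hν : 0 < ν) (hβ : 0 < β) (hαhat : 0 < αhat)
    (m' ν' α' β' z σ : ℝ)
    (hm' : m' = (ν * m + y) / (ν + 1))
    (hν' : ν' = ν + 1)
    (hα' : α' = αhat + 1 / 2)
    (hz : z = y - m)
    (hβ' : β' = β + (ν / (ν + 1)) * z ^ 2 / 2)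
    (hσ : σ = β * (ν + 1) / ν) :
    -deriv (fun α : ℝ =>
        α' * (m - m') ^ 2 * ν / (2 * β') + ν / (2 * ν') - (1 / 2) * Real.log (ν / ν')
          - 1 / 2 - α * Real.log (β / β') + Real.log (Real.Gamma α / Real.Gamma α')
          - (α - α') * digamma α' + α' * (β - β') / β') αhat
      = -(Real.log (1 + z ^ 2 / (2 * σ)) + digamma αhat - digamma (αhat + 1 / 2)) := by
  have hβ'_pos : 0 < β' := by rw [hβ']; positivity
  have hΓ : Real.Gamma α' ≠ 0 := (Real.Gamma_pos_of_pos (by rw [hα']; positivity)).ne'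
  have hlog : Real.log (1 + z ^ 2 / (2 * σ)) = -Real.log (β / β') := by
    rw [← Real.log_inv, inv_div, hβ', hσ]
    congr 1
    field_simp
  have hderiv := (((((hasDerivAt_id' αhat).mul_const (Real.log (β / β'))).const_sub
    (α' * (m - m') ^ 2 * ν / (2 * β') + ν / (2 * ν') - (1 / 2) * Real.log (ν / ν') - 1 / 2)).add
    (hasDerivAt_log_Gamma_div hαhat hΓ)).sub
    (((hasDerivAt_id' αhat).sub_const α').mul_const (digamma α'))).add_const
    (α' * (β - β') / β')
  rw [hlog, ← hα']
  refine congrArg Neg.neg (hderiv.deriv.trans ?_)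
  ring
end

section
/- Fix m ∈ ℝ, ν, α > 0 and y ∈ ℝ, set z := y − m, and let m' = (νm + y)/(ν+1), ν' = ν+1, α' = α+1/2, β' = β̂ + (ν/(ν+1))z²/2 evaluated at a point β̂ > 0, held fixed. Define K(β) := α'(m−m')²ν/(2β') + ν/(2ν') − (1/2)ln(ν/ν') − 1/2 − α·ln(β/β') + ln(Γ(α)/Γ(α')) − (α−α')Ψ(α') + α'(β−β')/β' as a function of β only. Then, with σ := β̂(ν+1)/ν, the negative derivative of K with respect to β evaluated at β = β̂ equals (1/β̂)·(αz² − σ)/(2σ + z²). -/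
/-- The negative gradient of the KL divergence `K` with respect to `β`, with the posterior
parameters `m', ν', α', β'` held fixed at their values computed from the current point `β̂`,
equals `(1/β̂)·(αz² − σ)/(2σ + z²)`, where `z = y − m` and `σ = β̂(ν+1)/ν`. -/
theorem gcp_neg_grad_beta
    (m ν α y βhat : ℝ) (hν : 0 < ν) (hα : 0 < α) (hβhat : 0 < βhat)
    (m' ν' α' β' z σ : ℝ)
    (hm' : m' = (ν * m + y) / (ν + 1))
    (hν' : ν' = ν + 1)
    (hα' : α' = α + 1 / 2)
    (hz : z = y - m)
    (hβ' : β' = βhat + (ν / (ν + 1)) * z ^ 2 / 2)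
    (hσ : σ = βhat * (ν + 1) / ν) :
    -deriv (fun β : ℝ =>
        α' * (m - m') ^ 2 * ν / (2 * β') + ν / (2 * ν') - (1 / 2) * Real.log (ν / ν')
          - 1 / 2 - α * Real.log (β / β') + Real.log (Real.Gamma α / Real.Gamma α')
          - (α - α') * digamma α' + α' * (β - β') / β') βhat
      = (1 / βhat) * ((α * z ^ 2 - σ) / (2 * σ + z ^ 2)) := by
  have hβ'pos : 0 < β' := by rw [hβ']; positivity
  have hσpos : 0 < σ := by rw [hσ]; positivity
  have hlog : HasDerivAt (fun β : ℝ => α * Real.log (β / β')) (α * (1 / β' / (βhat / β'))) βhat :=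
    (((hasDerivAt_id βhat).div_const β').log (div_pos hβhat hβ'pos).ne').const_mul α
  have hlin : HasDerivAt (fun β : ℝ => α' * (β - β') / β') (α' * 1 / β') βhat :=
    (((hasDerivAt_id βhat).sub_const β').const_mul α').div_const β'
  have hK := (((hlog.const_sub (α' * (m - m') ^ 2 * ν / (2 * β') + ν / (2 * ν')
    - (1 / 2) * Real.log (ν / ν') - 1 / 2)).add_const
      (Real.log (Real.Gamma α / Real.Gamma α'))).sub_const ((α - α') * digamma α')).add hlin
  have hβ'σ : β' = βhat * (2 * σ + z ^ 2) / (2 * σ) := by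
    rw [hβ', hσ]
    field_simp
  have hden : 2 * σ + z ^ 2 ≠ 0 := by positivity
  refine (congrArg Neg.neg hK.deriv).trans ?_
  rw [hβ'σ, hα']
  field_simp
  ring
end

section
/- Fix m ∈ ℝ, α, β > 0 and y ∈ ℝ, set z := y − m, and let m' = (ν̂m + y)/(ν̂+1), ν' = ν̂+1, α' = α+1/2, β' = β + (ν̂/(ν̂+1))z²/2 evaluated at a point ν̂ > 0, held fixed. Define K(ν) := α'(m−m')²ν/(2β') + ν/(2ν') − (1/2)ln(ν/ν') − 1/2 − α·ln(β/β') + ln(Γ(α)/Γ(α')) − (α−α')Ψ(α') + α'(β−β')/β' as a function of ν only. Then, with σ := β(ν̂+1)/ν̂, the negative derivative of K with respect to ν evaluated at ν = ν̂ equals −(1/(ν̂(ν̂+1)))·(αz² − σ)/(2σ + z²). -/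
/-- The negative gradient of the KL divergence `K` with respect to `ν`, with the posterior
parameters `m', ν', α', β'` held fixed at their values computed from the current point `ν̂`,
equals `−(1/(ν̂(ν̂+1)))·(αz² − σ)/(2σ + z²)`, where `z = y − m` and `σ = β(ν̂+1)/ν̂`. -/
theorem gcp_neg_grad_nu
    (m α β y νhat : ℝ) (hα : 0 < α) (hβ : 0 < β) (hνhat : 0 < νhat)
    (m' ν' α' β' z σ : ℝ)
    (hm' : m' = (νhat * m + y) / (νhat + 1))
    (hν' : ν' = νhat + 1)
    (hα' : α' = α + 1 / 2)
    (hz : z = y - m)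
    (hβ' : β' = β + (νhat / (νhat + 1)) * z ^ 2 / 2)
    (hσ : σ = β * (νhat + 1) / νhat) :
    -deriv (fun ν : ℝ =>
        α' * (m - m') ^ 2 * ν / (2 * β') + ν / (2 * ν') - (1 / 2) * Real.log (ν / ν')
          - 1 / 2 - α * Real.log (β / β') + Real.log (Real.Gamma α / Real.Gamma α')
          - (α - α') * digamma α' + α' * (β - β') / β') νhat
      = -(1 / (νhat * (νhat + 1))) * ((α * z ^ 2 - σ) / (2 * σ + z ^ 2)) := by
  have hn1 : 0 < νhat + 1 := by linarith
  have hν'0 : ν' ≠ 0 := hν' ▸ hn1.ne'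
  have hσ0 : 0 < σ := by rw [hσ]; positivity
  have hden : 2 * σ + z ^ 2 ≠ 0 := by positivity
  have hβσ : 2 * β' = νhat / (νhat + 1) * (2 * σ + z ^ 2) := by
    rw [hβ', hσ]; field_simp
  have hmm : m - m' = -z / (νhat + 1) := by
    rw [hm', hz]; field_simp; ring
  have hlog : HasDerivAt (fun ν : ℝ => Real.log (ν / ν')) (1 / ν' / (νhat / ν')) νhat :=
    ((hasDerivAt_id νhat).div_const ν').log (div_ne_zero hνhat.ne' hν'0)
  have hK := ((((((((((hasDerivAt_id νhat).const_mul (α' * (m - m') ^ 2)).div_const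
    (2 * β')).add ((hasDerivAt_id νhat).div_const (2 * ν'))).sub
    (hlog.const_mul (1 / 2))).sub_const (1 / 2)).sub_const (α * Real.log (β / β'))).add_const
    (Real.log (Real.Gamma α / Real.Gamma α'))).sub_const
    ((α - α') * digamma α')).add_const (α' * (β - β') / β'))
  refine (congrArg Neg.neg hK.deriv).trans ?_
  rw [hβσ, hmm, hα', hν']
  field_simp
  ring
end

section
/- Let p be a probability density on ℝ, let m ∈ ℝ, write z := y − m, and suppose the moments μ_k := ∫ z^k p(y) dy are finite for k = 2, 4, 6. Then, as σ → +∞, ∫_ℝ ln(1 + z²/(2σ)) p(y) dy = μ_2/(2σ) − μ_4/(8σ²) + R(σ), where |R(σ)| ≤ μ_6/(24σ³). In particular the integral equals μ_2/(2σ) − μ_4/(8σ²) + O(σ^{-3}) as σ → ∞. -/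
open MeasureTheory Filter Asymptotics

lemma nonneg_of_hasDerivAt_nonneg {f f' : ℝ → ℝ} (h0 : f 0 = 0)
    (hf : ∀ x, 0 ≤ x → HasDerivAt f (f' x) x) (hf' : ∀ x, 0 ≤ x → 0 ≤ f' x)
    {u : ℝ} (hu : 0 ≤ u) : 0 ≤ f u := by
  have hmono : MonotoneOn f (Set.Ici 0) := by
    refine monotoneOn_of_hasDerivWithinAt_nonneg (convex_Ici 0)
      (fun x hx => (hf x hx).continuousAt.continuousWithinAt)
      (f' := f') (fun x hx => ?_) (fun x hx => ?_)
    · exact (hf x (interior_subset hx)).hasDerivWithinAt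
    · exact hf' x (interior_subset hx)
  simpa [h0] using hmono Set.self_mem_Ici hu hu

lemma hasDerivAt_log_one_add_sub_quadratic {x : ℝ} (hx : 0 ≤ x) :
    HasDerivAt (fun u : ℝ => Real.log (1 + u) - u + u ^ 2 / 2) (x ^ 2 / (1 + x)) x := by
  have hx1 : 1 + x ≠ 0 := by positivity
  refine (((((hasDerivAt_id' x).const_add 1).log hx1).sub (hasDerivAt_id' x)).add
    ((hasDerivAt_pow 2 x).div_const 2)).congr_deriv ?_
  field_simp
  ring

lemma log_one_add_sub_quadratic_nonneg {u : ℝ} (hu : 0 ≤ u) :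
    0 ≤ Real.log (1 + u) - u + u ^ 2 / 2 :=
  nonneg_of_hasDerivAt_nonneg (f := fun u : ℝ => Real.log (1 + u) - u + u ^ 2 / 2) (by simp)
    (fun _ hx => hasDerivAt_log_one_add_sub_quadratic hx) (fun _ _ => by positivity) hu

lemma log_one_add_sub_quadratic_le {u : ℝ} (hu : 0 ≤ u) :
    Real.log (1 + u) - u + u ^ 2 / 2 ≤ u ^ 3 / 3 := by
  refine sub_nonneg.mp (nonneg_of_hasDerivAt_nonneg
    (f := fun u : ℝ => u ^ 3 / 3 - (Real.log (1 + u) - u + u ^ 2 / 2)) (by simp)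
    (fun x hx => ((hasDerivAt_pow 3 x).div_const 3).sub
      (hasDerivAt_log_one_add_sub_quadratic hx)) (fun x hx => ?_) hu)
  have h : x ^ 2 / (1 + x) ≤ x ^ 2 := div_le_self (sq_nonneg x) (by linarith)
  norm_num
  linarith

/-- Large-`σ` expansion of `∫ ln(1 + z²/(2σ)) p(y) dy` with `z = y − m`: the integral equals
`μ₂/(2σ) − μ₄/(8σ²) + R(σ)` with `|R(σ)| ≤ μ₆/(24σ³)`; in particular the remainder is
`O(σ⁻³)` as `σ → ∞`. -/
theorem log_integral_large_sigma_expansion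
    (p : ℝ → ℝ) (m μ₂ μ₄ μ₆ : ℝ)
    (hpos : ∀ y, 0 ≤ p y)
    (hnorm : ∫ y, p y = 1)
    (hint : ∀ k : ℕ, k = 2 ∨ k = 4 ∨ k = 6 → Integrable (fun y => (y - m) ^ k * p y))
    (hμ₂ : μ₂ = ∫ y, (y - m) ^ 2 * p y)
    (hμ₄ : μ₄ = ∫ y, (y - m) ^ 4 * p y)
    (hμ₆ : μ₆ = ∫ y, (y - m) ^ 6 * p y) :
    (∀ σ : ℝ, 0 < σ →
      |(∫ y, Real.log (1 + (y - m) ^ 2 / (2 * σ)) * p y)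
          - (μ₂ / (2 * σ) - μ₄ / (8 * σ ^ 2))| ≤ μ₆ / (24 * σ ^ 3)) ∧
    (fun σ : ℝ => (∫ y, Real.log (1 + (y - m) ^ 2 / (2 * σ)) * p y)
        - (μ₂ / (2 * σ) - μ₄ / (8 * σ ^ 2))) =O[atTop] fun σ : ℝ => σ ^ (-3 : ℤ) := by
  have hp : Integrable p := Integrable.of_integral_ne_zero (by rw [hnorm]; exact one_ne_zero)
  have h2 := hint 2 (by simp)
  have h4 := hint 4 (by simp)
  have h6 := hint 6 (by simp)
  have key : ∀ σ : ℝ, 0 < σ →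
      |(∫ y, Real.log (1 + (y - m) ^ 2 / (2 * σ)) * p y)
          - (μ₂ / (2 * σ) - μ₄ / (8 * σ ^ 2))| ≤ μ₆ / (24 * σ ^ 3) := by
    intro σ hσ
    have hu : ∀ y, 0 ≤ (y - m) ^ 2 / (2 * σ) := fun y => by positivity
    have hlog : Integrable (fun y => Real.log (1 + (y - m) ^ 2 / (2 * σ)) * p y) := by
      refine (h2.div_const (2 * σ)).mono'
        (AEStronglyMeasurable.mul
          (Real.measurable_log.comp (by fun_prop)).aestronglyMeasurable hp.aestronglyMeasurable) (ae_of_all _ fun y => ?_)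
      have hl := Real.log_nonneg (le_add_of_nonneg_right (hu y) : 1 ≤ 1 + (y - m) ^ 2 / (2 * σ))
      have hle := Real.log_le_sub_one_of_pos (by linarith [hu y] : 0 < 1 + (y - m) ^ 2 / (2 * σ))
      rw [Real.norm_of_nonneg (mul_nonneg hl (hpos y)), mul_div_right_comm]
      exact mul_le_mul_of_nonneg_right (by linarith) (hpos y)
    have hquad : Integrable (fun y =>
        (y - m) ^ 2 * p y / (2 * σ) - (y - m) ^ 4 * p y / (8 * σ ^ 2)) :=
      (h2.div_const (2 * σ)).sub (h4.div_const (8 * σ ^ 2))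
    have heq : (∫ y, Real.log (1 + (y - m) ^ 2 / (2 * σ)) * p y)
          - (μ₂ / (2 * σ) - μ₄ / (8 * σ ^ 2)) =
        ∫ y, (Real.log (1 + (y - m) ^ 2 / (2 * σ)) - (y - m) ^ 2 / (2 * σ)
          + ((y - m) ^ 2 / (2 * σ)) ^ 2 / 2) * p y := by
      rw [hμ₂, hμ₄, ← integral_div, ← integral_div,
        ← integral_sub (h2.div_const _) (h4.div_const _), ← integral_sub hlog hquad]
      refine integral_congr_ae (ae_of_all _ fun y => ?_)
      dsimp only
      field_simp
      ring
    rw [heq, hμ₆, ← integral_div, ← Real.norm_eq_abs]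
    refine norm_integral_le_of_norm_le (h6.div_const _) (ae_of_all _ fun y => ?_)
    rw [Real.norm_of_nonneg
      (mul_nonneg (log_one_add_sub_quadratic_nonneg (hu y)) (hpos y))]
    calc _ ≤ ((y - m) ^ 2 / (2 * σ)) ^ 3 / 3 * p y :=
          mul_le_mul_of_nonneg_right (log_one_add_sub_quadratic_le (hu y)) (hpos y)
      _ = _ := by
          field_simp
          ring
  refine ⟨key, IsBigO.of_bound (μ₆ / 24) ?_⟩
  filter_upwards [eventually_gt_atTop 0] with σ hσ
  have hz : σ ^ (-3 : ℤ) = (σ ^ 3)⁻¹ := by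
    rw [zpow_neg]
    norm_cast
  rw [Real.norm_eq_abs, hz, Real.norm_of_nonneg (by positivity)]
  refine (key σ hσ).trans_eq ?_
  field_simp
end

section
/- Let p be a probability density on ℝ, let m ∈ ℝ, write z := y − m, and suppose ∫ |z|^5 p(y) dy < ∞; set μ_k := ∫ z^k p(y) dy for k = 1, 3 and μ̄_5 := ∫ |z|^5 p(y) dy. Then, as σ → +∞, ∫_ℝ z/(2σ + z²) p(y) dy = μ_1/(2σ) − μ_3/(4σ²) + R(σ), where |R(σ)| ≤ μ̄_5/(8σ³). In particular the integral equals μ_1/(2σ) − μ_3/(4σ²) + O(σ^{-3}) as σ → ∞. -/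
open MeasureTheory Filter Asymptotics

/-- Exact expansion of `z / (a + z²)` in powers of `1 / a`, with the remainder in closed form. -/
lemma div_add_sq_eq_expansion {a : ℝ} (ha : 0 < a) (z : ℝ) :
    z / (a + z ^ 2) = z / a - z ^ 3 / a ^ 2 + z ^ 5 / (a ^ 2 * (a + z ^ 2)) := by
  have h : a + z ^ 2 ≠ 0 := by positivity
  field_simp
  ring

lemma abs_pow_five_div_le {a : ℝ} (ha : 0 < a) (z : ℝ) :
    |z ^ 5 / (a ^ 2 * (a + z ^ 2))| ≤ |z| ^ 5 / a ^ 3 := by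
  have h : 0 < a ^ 2 * (a + z ^ 2) := by positivity
  rw [abs_div, abs_pow, abs_of_pos h]
  gcongr
  nlinarith [mul_nonneg (sq_nonneg a) (sq_nonneg z)]

lemma abs_integral_div_add_sq_sub_le {p : ℝ → ℝ} {m a : ℝ} (hpos : ∀ y, 0 ≤ p y)
    (hp : AEStronglyMeasurable p) (h1 : Integrable (fun y => (y - m) * p y))
    (h3 : Integrable (fun y => (y - m) ^ 3 * p y))
    (h5 : Integrable (fun y => |y - m| ^ 5 * p y)) (ha : 0 < a) :
    |(∫ y, (y - m) / (a + (y - m) ^ 2) * p y)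
        - ((∫ y, (y - m) * p y) / a - (∫ y, (y - m) ^ 3 * p y) / a ^ 2)|
      ≤ (∫ y, |y - m| ^ 5 * p y) / a ^ 3 := by
  have hbound : ∀ y, ‖(y - m) ^ 5 / (a ^ 2 * (a + (y - m) ^ 2)) * p y‖
      ≤ |y - m| ^ 5 * p y / a ^ 3 := fun y => by
    rw [Real.norm_eq_abs, abs_mul, abs_of_nonneg (hpos y), mul_div_right_comm]
    exact mul_le_mul_of_nonneg_right (abs_pow_five_div_le ha _) (hpos y)
  have hmeas : Measurable fun y : ℝ => (y - m) ^ 5 / (a ^ 2 * (a + (y - m) ^ 2)) := by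
    fun_prop
  have hrem : Integrable fun y => (y - m) ^ 5 / (a ^ 2 * (a + (y - m) ^ 2)) * p y :=
    (h5.div_const (a ^ 3)).mono' (hmeas.aestronglyMeasurable.mul hp) (.of_forall hbound)
  have hsplit : ∀ y, (y - m) / (a + (y - m) ^ 2) * p y
      = (y - m) * p y / a - (y - m) ^ 3 * p y / a ^ 2
        + (y - m) ^ 5 / (a ^ 2 * (a + (y - m) ^ 2)) * p y := fun y => by
    rw [div_add_sq_eq_expansion ha]
    ring
  have hmain : Integrable fun y => (y - m) * p y / a - (y - m) ^ 3 * p y / a ^ 2 :=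
    (h1.div_const a).sub (h3.div_const (a ^ 2))
  rw [integral_congr_ae (.of_forall hsplit), integral_add hmain hrem,
    integral_sub (h1.div_const a) (h3.div_const (a ^ 2)), integral_div, integral_div,
    add_sub_cancel_left, ← integral_div]
  exact norm_integral_le_of_norm_le (h5.div_const (a ^ 3)) (.of_forall hbound)

/-- Large-`σ` expansion of `∫ z/(2σ + z²) p(y) dy` with `z = y − m`: the integral equals
`μ₁/(2σ) − μ₃/(4σ²) + R(σ)` with `|R(σ)| ≤ μbar₅/(8σ³)`, where `μbar₅ = ∫|z|⁵ p dy`; in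
particular the remainder is `O(σ⁻³)` as `σ → ∞`. -/
theorem ratio_integral_large_sigma_expansion
    (p : ℝ → ℝ) (m μ₁ μ₃ μbar₅ : ℝ)
    (hpos : ∀ y, 0 ≤ p y)
    (hnorm : ∫ y, p y = 1)
    (hint5 : Integrable (fun y => |y - m| ^ 5 * p y))
    (hint : ∀ k : ℕ, k = 1 ∨ k = 3 → Integrable (fun y => (y - m) ^ k * p y))
    (hμ₁ : μ₁ = ∫ y, (y - m) * p y)
    (hμ₃ : μ₃ = ∫ y, (y - m) ^ 3 * p y)
    (hμbar₅ : μbar₅ = ∫ y, |y - m| ^ 5 * p y) :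
    (∀ σ : ℝ, 0 < σ →
      |(∫ y, (y - m) / (2 * σ + (y - m) ^ 2) * p y)
          - (μ₁ / (2 * σ) - μ₃ / (4 * σ ^ 2))| ≤ μbar₅ / (8 * σ ^ 3)) ∧
    (fun σ : ℝ => (∫ y, (y - m) / (2 * σ + (y - m) ^ 2) * p y)
        - (μ₁ / (2 * σ) - μ₃ / (4 * σ ^ 2))) =O[atTop] fun σ : ℝ => σ ^ (-3 : ℤ) := by
  have hp : Integrable p := not_imp_comm.1 integral_undef (by simp [hnorm])
  have h1 : Integrable fun y => (y - m) * p y := by simpa using hint 1 (.inl rfl)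
  have hbound : ∀ σ : ℝ, 0 < σ →
      |(∫ y, (y - m) / (2 * σ + (y - m) ^ 2) * p y)
          - (μ₁ / (2 * σ) - μ₃ / (4 * σ ^ 2))| ≤ μbar₅ / (8 * σ ^ 3) := fun σ hσ => by
    have h := abs_integral_div_add_sq_sub_le hpos hp.aestronglyMeasurable h1
      (hint 3 (.inr rfl)) hint5 (a := 2 * σ) (by positivity)
    rw [← hμ₁, ← hμ₃, ← hμbar₅] at h
    convert h using 4 <;> ring
  refine ⟨hbound, .of_bound (μbar₅ / 8) ?_⟩
  filter_upwards [eventually_gt_atTop 0] with σ hσ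
  rw [Real.norm_eq_abs, Real.norm_eq_abs, abs_of_pos (zpow_pos hσ _)]
  refine (hbound σ hσ).trans_eq ?_
  rw [zpow_neg, div_mul_eq_div_div, div_eq_mul_inv]
  norm_cast
end

section
/- For every pair (α, σ) ∈ (0,∞) × (0,∞) there exist ε ∈ (0,1), m_g ∈ ℝ, V_g > 0, m_o ∈ ℝ, V_o > 0, and a probability density p_o on ℝ with mean m_o and variance V_o, such that (α, σ) is an equilibrium of the G- and H-equations of the GCP system with m = m_g; that is, G(m_g, α, σ, ε) = 0 and H(m_g, α, σ, ε) = 0, where p_c(y) = (1−ε)·N(y; m_g, V_g) + ε·p_o(y). In other words, every finite pair (α, σ) is realizable as a fitted GCP equilibrium for some ground truth and outlier configuration. -/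
open MeasureTheory

/-- The Gaussian density with mean `m` and variance `v`. -/
noncomputable def gaussianPDF (m v y : ℝ) : ℝ :=
  Real.exp (-((y - m) ^ 2) / (2 * v)) / Real.sqrt (2 * Real.pi * v)

lemma hasDerivAt_log_Gamma {x : ℝ} (hx : 0 < x) :
    HasDerivAt (Real.log ∘ Real.Gamma) (digamma x) x := by
  have h := (Real.differentiableAt_Gamma (s := x) fun m hm => by
    have : (0 : ℝ) ≤ m := m.cast_nonneg
    linarith).hasDerivAt
  exact h.log (Real.Gamma_pos_of_pos hx).ne'

lemma log_Gamma_add_one {x : ℝ} (hx : 0 < x) :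
    (Real.log ∘ Real.Gamma) (x + 1) = Real.log x + (Real.log ∘ Real.Gamma) x := by
  simp only [Function.comp_apply]
  rw [Real.Gamma_add_one hx.ne', Real.log_mul hx.ne' (Real.Gamma_pos_of_pos hx).ne']

lemma digamma_add_one {x : ℝ} (hx : 0 < x) : digamma (x + 1) = digamma x + 1 / x := by
  have h1 : HasDerivAt (fun y => (Real.log ∘ Real.Gamma) (y + 1)) (digamma (x + 1)) x :=
    (hasDerivAt_log_Gamma (by linarith : 0 < x + 1)).comp_add_const x 1
  have h2 := (Real.hasDerivAt_log hx.ne').add (hasDerivAt_log_Gamma hx)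
  have h3 := h2.congr_of_eventuallyEq (f₁ := fun y => (Real.log ∘ Real.Gamma) (y + 1)) (by
    filter_upwards [lt_mem_nhds hx] with y hy
    exact log_Gamma_add_one hy)
  rw [h1.unique h3, one_div, add_comm]

lemma digamma_le_log {x : ℝ} (hx : 0 < x) : digamma x ≤ Real.log x := by
  have h := Real.convexOn_log_Gamma.le_slope_of_hasDerivAt (x := x) (y := x + 1) hx
    (by simp; linarith) (by linarith) (hasDerivAt_log_Gamma hx)
  rw [slope_def_field, log_Gamma_add_one hx] at h
  simpa using h

lemma log_sub_le_digamma {x : ℝ} (hx : 0 < x) : Real.log x - 1 / x ≤ digamma x := by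
  have h := Real.convexOn_log_Gamma.slope_le_of_hasDerivAt (x := x) (y := x + 1) hx
    (by simp; linarith) (by linarith) (hasDerivAt_log_Gamma (by linarith))
  rw [slope_def_field, log_Gamma_add_one hx, digamma_add_one hx] at h
  simp at h
  rw [one_div]
  linarith

/-- The excess of `Ψ(x + 1/2) - Ψ(x)` over `log (x + 1/2) - log x`. -/
noncomputable def digammaExcess (x : ℝ) : ℝ :=
  (digamma (x + 1 / 2) - Real.log (x + 1 / 2)) - (digamma x - Real.log x)

lemma digammaExcess_add_one_lt {x : ℝ} (hx : 0 < x) :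
    digammaExcess (x + 1) < digammaExcess x := by
  unfold digammaExcess
  have e : x + 1 + 1 / 2 = x + 1 / 2 + 1 := by ring
  rw [e, digamma_add_one hx, digamma_add_one (by linarith : 0 < x + 1 / 2)]
  have hprod : Real.log ((x + 1) * (x + 1 / 2) / (x * (x + 1 / 2 + 1))) =
      Real.log (x + 1) + Real.log (x + 1 / 2) - (Real.log x + Real.log (x + 1 / 2 + 1)) := by
    rw [Real.log_div (by positivity) (by positivity), Real.log_mul (by positivity) (by positivity),
      Real.log_mul (by positivity) (by positivity)]
  have hle := Real.log_le_sub_one_of_pos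
    (show 0 < (x + 1) * (x + 1 / 2) / (x * (x + 1 / 2 + 1)) by positivity)
  have hlt : (x + 1) * (x + 1 / 2) / (x * (x + 1 / 2 + 1)) - 1 < 1 / x - 1 / (x + 1 / 2) := by
    have e1 : (x + 1) * (x + 1 / 2) / (x * (x + 1 / 2 + 1)) - 1 =
        (1 / 2) / (x * (x + 1 / 2 + 1)) := by field_simp; ring
    have e2 : 1 / x - 1 / (x + 1 / 2) = (1 / 2) / (x * (x + 1 / 2)) := by field_simp; ring
    rw [e1, e2]
    exact div_lt_div_of_pos_left (by norm_num) (by positivity)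
      (mul_lt_mul_of_pos_left (by linarith) hx)
  linarith

lemma digammaExcess_nonneg {x : ℝ} (hx : 0 < x) : 0 ≤ digammaExcess x := by
  have hanti : ∀ n : ℕ, digammaExcess (x + n) ≤ digammaExcess x := by
    intro n
    induction n with
    | zero => simp
    | succ n ih =>
      have := digammaExcess_add_one_lt (x := x + n) (by positivity)
      push_cast
      rw [← add_assoc]
      linarith
  have hlow : ∀ n : ℕ, -(1 / ((n : ℝ) + 1 / 2 + x)) ≤ digammaExcess x := by
    intro n
    have h1 := digamma_le_log (x := x + n) (by positivity)
    have h2 := log_sub_le_digamma (x := x + n + 1 / 2) (by positivity)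
    have h3 := hanti n
    unfold digammaExcess at h3 ⊢
    rw [show (n : ℝ) + 1 / 2 + x = x + n + 1 / 2 by ring]
    linarith
  have ht : Filter.Tendsto (fun n : ℕ => -(1 / ((n : ℝ) + 1 / 2 + x))) Filter.atTop (nhds 0) := by
    have h : Filter.Tendsto (fun n : ℕ => (n : ℝ) + 1 / 2 + x) Filter.atTop Filter.atTop :=
      Filter.tendsto_atTop_add_const_right _ _
        (Filter.tendsto_atTop_add_const_right _ _ tendsto_natCast_atTop_atTop)
    simpa using h.inv_tendsto_atTop.neg
  exact le_of_tendsto' ht hlow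

lemma log_sub_log_lt_digamma_sub {x : ℝ} (hx : 0 < x) :
    Real.log (x + 1 / 2) - Real.log x < digamma (x + 1 / 2) - digamma x := by
  have h1 := digammaExcess_add_one_lt hx
  have h2 := digammaExcess_nonneg (x := x + 1) (by linarith)
  have h3 : 0 < digammaExcess x := by linarith
  unfold digammaExcess at h3
  linarith

/-- `A` and `B` are the expectations of `(1 + y² / (2σ))⁻¹` and of `log (1 + y² / (2σ))` under some
probability density with finite second moment. -/
def IsMomentPair (σ A B : ℝ) : Prop :=
  ∃ p : ℝ → ℝ, (∀ y, 0 ≤ p y) ∧ Integrable p ∧ (∫ y, p y) = 1 ∧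
    Integrable (fun y => y * p y) ∧ Integrable (fun y => y ^ 2 * p y) ∧
    Integrable (fun y => (1 + y ^ 2 / (2 * σ))⁻¹ * p y) ∧
    (∫ y, (1 + y ^ 2 / (2 * σ))⁻¹ * p y) = A ∧
    Integrable (fun y => Real.log (1 + y ^ 2 / (2 * σ)) * p y) ∧
    (∫ y, Real.log (1 + y ^ 2 / (2 * σ)) * p y) = B

lemma integral_mul_mix {f p q : ℝ → ℝ} (s t : ℝ) (hp : Integrable (fun y => f y * p y))
    (hq : Integrable (fun y => f y * q y)) :
    Integrable (fun y => f y * (s * p y + t * q y)) ∧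
      (∫ y, f y * (s * p y + t * q y)) = s * (∫ y, f y * p y) + t * ∫ y, f y * q y := by
  have e : (fun y => f y * (s * p y + t * q y)) =
      fun y => s * (f y * p y) + t * (f y * q y) := by
    ext y; ring
  rw [e, integral_add (hp.const_mul s) (hq.const_mul t), integral_const_mul, integral_const_mul]
  exact ⟨(hp.const_mul s).add (hq.const_mul t), rfl⟩

lemma IsMomentPair.mix {σ A B A' B' s t : ℝ} (h : IsMomentPair σ A B) (h' : IsMomentPair σ A' B')
    (hs : 0 ≤ s) (ht : 0 ≤ t) (hst : s + t = 1) :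
    IsMomentPair σ (s * A + t * A') (s * B + t * B') := by
  obtain ⟨p, p0, pi, p1, pm, pv, pa, rfl, pb, rfl⟩ := h
  obtain ⟨q, q0, qi, q1, qm, qv, qa, rfl, qb, rfl⟩ := h'
  have ha := integral_mul_mix s t pa qa
  have hb := integral_mul_mix s t pb qb
  refine ⟨fun y => s * p y + t * q y,
    fun y => add_nonneg (mul_nonneg hs (p0 y)) (mul_nonneg ht (q0 y)),
    (pi.const_mul s).add (qi.const_mul t), ?_, (integral_mul_mix s t pm qm).1,
    (integral_mul_mix s t pv qv).1, ha.1, ha.2, hb.1, hb.2⟩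
  rw [integral_add (pi.const_mul s) (qi.const_mul t), integral_const_mul, integral_const_mul,
    p1, q1]
  linarith

/-- The moment pair of the uniform density on `[c, d]`. -/
lemma exists_isMomentPair_Icc {σ c d : ℝ} (hσ : 0 < σ) (hc : 0 ≤ c) (hcd : c < d) :
    ∃ A B, IsMomentPair σ A B ∧ (1 + d ^ 2 / (2 * σ))⁻¹ ≤ A ∧ A ≤ (1 + c ^ 2 / (2 * σ))⁻¹ ∧
      Real.log (1 + c ^ 2 / (2 * σ)) ≤ B ∧ B ≤ Real.log (1 + d ^ 2 / (2 * σ)) := by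
  set p : ℝ → ℝ := (Set.Icc c d).indicator fun _ => (d - c)⁻¹ with hp
  have hpos : 0 < d - c := sub_pos.2 hcd
  have p0 : ∀ y, 0 ≤ p y := fun y => Set.indicator_nonneg (fun _ _ => (inv_pos.2 hpos).le) y
  have hint : ∀ f : ℝ → ℝ, Continuous f → Integrable (fun y => f y * p y) := by
    intro f hf
    have e : (fun y => f y * p y) = (Set.Icc c d).indicator fun y => f y * (d - c)⁻¹ := by
      ext y
      simp only [hp, Set.indicator_apply]
      split_ifs <;> simp
    rw [e, integrable_indicator_iff measurableSet_Icc]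
    exact (hf.mul continuous_const).continuousOn.integrableOn_Icc
  have pi : Integrable p := by simpa using hint (fun _ => 1) continuous_const
  have p1 : (∫ y, p y) = 1 := by
    rw [hp, integral_indicator measurableSet_Icc, setIntegral_const]
    simp [Measure.real, hcd.le, hpos.ne']
  have hbd : ∀ (f : ℝ → ℝ) (k K : ℝ), Continuous f → (∀ y ∈ Set.Icc c d, k ≤ f y ∧ f y ≤ K) →
      k ≤ (∫ y, f y * p y) ∧ (∫ y, f y * p y) ≤ K := by
    intro f k K hf hb
    have hk : ∀ k : ℝ, (∫ y, k * p y) = k := fun k => by rw [integral_const_mul, p1, mul_one]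
    constructor
    · rw [← hk k]
      refine integral_mono (pi.const_mul k) (hint f hf) fun y => ?_
      by_cases hy : y ∈ Set.Icc c d
      · exact mul_le_mul_of_nonneg_right (hb y hy).1 (p0 y)
      · simp [hp, hy]
    · conv_rhs => rw [← hk K]
      refine integral_mono (hint f hf) (pi.const_mul K) fun y => ?_
      by_cases hy : y ∈ Set.Icc c d
      · exact mul_le_mul_of_nonneg_right (hb y hy).2 (p0 y)
      · simp [hp, hy]
  have hne : ∀ y : ℝ, 0 < 1 + y ^ 2 / (2 * σ) := fun y => by positivity
  have c0 : Continuous fun y : ℝ => 1 + y ^ 2 / (2 * σ) := by fun_prop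
  have ca : Continuous fun y : ℝ => (1 + y ^ 2 / (2 * σ))⁻¹ := c0.inv₀ fun y => (hne y).ne'
  have cb := c0.log fun y => (hne y).ne'
  have hmono : ∀ y ∈ Set.Icc c d, 1 + c ^ 2 / (2 * σ) ≤ 1 + y ^ 2 / (2 * σ) ∧
      1 + y ^ 2 / (2 * σ) ≤ 1 + d ^ 2 / (2 * σ) := by
    intro y hy
    have : 0 ≤ y := hc.trans hy.1
    constructor
    · have := hy.1
      gcongr
    · have := hy.2
      gcongr
  obtain ⟨a1, a2⟩ := hbd _ (1 + d ^ 2 / (2 * σ))⁻¹ (1 + c ^ 2 / (2 * σ))⁻¹ ca fun y hy =>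
    ⟨inv_anti₀ (hne y) (hmono y hy).2, inv_anti₀ (hne c) (hmono y hy).1⟩
  obtain ⟨b1, b2⟩ := hbd _ (Real.log (1 + c ^ 2 / (2 * σ))) (Real.log (1 + d ^ 2 / (2 * σ))) cb
    fun y hy => ⟨Real.log_le_log (hne c) (hmono y hy).1, Real.log_le_log (hne y) (hmono y hy).2⟩
  exact ⟨_, _, ⟨p, p0, pi, p1, hint _ continuous_id, hint _ (by fun_prop), hint _ ca, rfl,
    hint _ cb, rfl⟩, a1, a2, b1, b2⟩

lemma exists_weights {u v x : ℝ} (hu : u ≤ x) (hv : x ≤ v) :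
    ∃ s t : ℝ, 0 ≤ s ∧ 0 ≤ t ∧ s + t = 1 ∧ s * u + t * v = x := by
  have : x ∈ segment ℝ u v := by rw [segment_eq_Icc (hu.trans hv)]; exact ⟨hu, hv⟩
  obtain ⟨s, t, hs, ht, hst, h⟩ := this
  exact ⟨s, t, hs, ht, hst, by simpa using h⟩

/-- Every point strictly above the curve `B = -log A`, `0 < A < 1`, is a moment pair. -/
lemma isMomentPair_of_neg_log_lt {σ A B : ℝ} (hσ : 0 < σ) (hA0 : 0 < A) (hA1 : A < 1)
    (hB : -Real.log A < B) : IsMomentPair σ A B := by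
  obtain ⟨w, hw, hwA⟩ : ∃ w : ℝ, 0 < w ∧ 1 + w ^ 2 / (2 * σ) = A⁻¹ := by
    have h1 : 1 < A⁻¹ := (one_lt_inv₀ hA0).2 hA1
    refine ⟨Real.sqrt (2 * σ * (A⁻¹ - 1)), Real.sqrt_pos.2 (by
      have : 0 < A⁻¹ - 1 := by linarith
      positivity), ?_⟩
    rw [Real.sq_sqrt (mul_nonneg (by linarith) (by linarith))]
    field_simp
    ring
  have hne : ∀ y : ℝ, 0 < 1 + y ^ 2 / (2 * σ) := fun y => by positivity
  have cb : Continuous fun y : ℝ => Real.log (1 + y ^ 2 / (2 * σ)) :=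
    Continuous.log (by fun_prop) fun y => (hne y).ne'
  have hlow : ∃ B₁ < B, IsMomentPair σ A B₁ := by
    have hev : ∀ᶠ y in nhdsWithin w (Set.Ioi w), Real.log (1 + y ^ 2 / (2 * σ)) < B :=
      (cb.continuousAt.eventually_lt continuousAt_const (by
        rw [hwA, Real.log_inv]; exact hB)).filter_mono nhdsWithin_le_nhds
    obtain ⟨d, hd, hwd⟩ := (hev.and self_mem_nhdsWithin).exists
    obtain ⟨A₁, B₁, h1, l1, -, -, u1⟩ := exists_isMomentPair_Icc hσ le_rfl hw
    obtain ⟨A₂, B₂, h2, -, l2, -, u2⟩ := exists_isMomentPair_Icc hσ hw.le hwd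
    rw [hwA, inv_inv] at l1 l2
    rw [hwA, Real.log_inv] at u1
    obtain ⟨s, t, hs, ht, hst, h⟩ := exists_weights l2 l1
    refine ⟨s * B₂ + t * B₁, ?_, h ▸ h2.mix h1 hs ht hst⟩
    have e1 : B₁ < B := u1.trans_lt hB
    have e2 : B₂ < B := u2.trans_lt hd
    have := convex_Iio B (x := B₂) e2 (y := B₁) e1 hs ht hst
    simpa using this
  have hhigh : ∃ B₂ > B, IsMomentPair σ A B₂ := by
    obtain ⟨A₁, B₁, h1, l1, u1, k1, -⟩ := exists_isMomentPair_Icc hσ le_rfl (half_pos hw)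
    have hA₁ : A < A₁ := by
      refine lt_of_lt_of_le ?_ l1
      rw [← inv_inv A, ← hwA]
      refine inv_strictAnti₀ (hne _) ?_
      have : w / 2 < w := by linarith
      gcongr
    have hA₁1 : A₁ ≤ 1 := by simpa using u1
    have hB₁ : 0 ≤ B₁ := by simpa using k1
    have ht : Filter.Tendsto (fun R : ℝ => Real.log (1 + R ^ 2 / (2 * σ))) Filter.atTop
        Filter.atTop := by
      refine Real.tendsto_log_atTop.comp (Filter.tendsto_atTop_add_const_left _ _ ?_)
      exact (Filter.tendsto_pow_atTop two_ne_zero).atTop_div_const (by linarith)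
    obtain ⟨R, hR, hwR⟩ := ((ht.eventually_gt_atTop (max 0 B / (A₁ - A))).and
      (Filter.eventually_ge_atTop w)).exists
    obtain ⟨A₂, B₂, h2, l2, u2, k2, -⟩ :=
      exists_isMomentPair_Icc hσ (hw.le.trans hwR) (lt_add_one R)
    have hA₂ : A₂ ≤ A := by
      refine u2.trans ?_
      rw [← inv_inv A, ← hwA]
      refine inv_anti₀ (hne _) ?_
      gcongr
    have hA₂0 : 0 ≤ A₂ := (inv_pos.2 (hne _)).le.trans l2
    obtain ⟨s, t, hs, ht, hst, h⟩ := exists_weights hA₂ hA₁.le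
    refine ⟨s * B₂ + t * B₁, ?_, h ▸ h2.mix h1 hs ht hst⟩
    have hpos : 0 < A₁ - A := sub_pos.2 hA₁
    have hs' : A₁ - A ≤ s := by
      have : A₁ - A = s * (A₁ - A₂) := by
        rw [← h, show t = 1 - s by linarith]; ring
      rw [this]
      exact mul_le_of_le_one_right hs (by linarith)
    have hB₂ : max 0 B / (A₁ - A) < B₂ := hR.trans_le k2
    have hB₂0 : 0 ≤ B₂ := le_trans (by positivity) hB₂.le
    calc B ≤ max 0 B := le_max_right _ _
      _ < B₂ * (A₁ - A) := (div_lt_iff₀ hpos).1 hB₂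
      _ ≤ B₂ * s := by gcongr
      _ ≤ s * B₂ + t * B₁ := by nlinarith [mul_nonneg ht hB₁]
  obtain ⟨B₁, hB₁, h1⟩ := hlow
  obtain ⟨B₂, hB₂, h2⟩ := hhigh
  obtain ⟨s, t, hs, ht, hst, h⟩ := exists_weights hB₁.le hB₂.le
  have := h1.mix h2 hs ht hst
  rwa [h, ← add_mul, hst, one_mul] at this

lemma integrable_mul_gaussianPDF {f : ℝ → ℝ} (hf : Continuous f) {C : ℝ}
    (hb : ∀ y, |f y| ≤ C * (1 + y ^ 2)) : Integrable (fun y => f y * gaussianPDF 0 1 y) := by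
  have e : ∀ y, gaussianPDF 0 1 y = (Real.sqrt (2 * Real.pi * 1))⁻¹ *
      Real.exp (-(1 / 2) * y ^ 2) := by
    intro y
    unfold gaussianPDF
    rw [div_eq_inv_mul]
    congr 2
    ring
  have h0 : Integrable fun y : ℝ => Real.exp (-(1 / 2) * y ^ 2) :=
    integrable_exp_neg_mul_sq (by norm_num)
  have h2 : Integrable fun y : ℝ => y ^ 2 * Real.exp (-(1 / 2) * y ^ 2) := by
    simpa using integrable_rpow_mul_exp_neg_mul_sq (b := 1 / 2) (by norm_num) (s := 2)
      (by norm_num)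
  refine Integrable.mono' (((h0.add h2).const_mul (C * (Real.sqrt (2 * Real.pi * 1))⁻¹))) ?_ ?_
  · simp only [e]
    exact Continuous.aestronglyMeasurable (by fun_prop)
  · refine Filter.Eventually.of_forall fun y => ?_
    rw [Real.norm_eq_abs, abs_mul, e, abs_of_pos (a := _ * Real.exp _) (by positivity)]
    calc |f y| * ((Real.sqrt (2 * Real.pi * 1))⁻¹ * Real.exp (-(1 / 2) * y ^ 2))
        ≤ C * (1 + y ^ 2) * ((Real.sqrt (2 * Real.pi * 1))⁻¹ * Real.exp (-(1 / 2) * y ^ 2)) := by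
          gcongr
          exact hb y
      _ = _ := by simp only [Pi.add_apply]; ring

lemma integral_gaussianPDF : (∫ y, gaussianPDF 0 1 y) = 1 := by
  have e : gaussianPDF 0 1 = ProbabilityTheory.gaussianPDFReal 0 1 := by
    ext y
    simp [gaussianPDF, ProbabilityTheory.gaussianPDFReal, div_eq_inv_mul]
  rw [e, ProbabilityTheory.integral_gaussianPDFReal_eq_one 0 one_ne_zero]

lemma integral_sq_sub_mul_pos {p : ℝ → ℝ} {m : ℝ} (p0 : ∀ y, 0 ≤ p y) (p1 : (∫ y, p y) = 1)
    (hi : Integrable (fun y => (y - m) ^ 2 * p y)) : 0 < ∫ y, (y - m) ^ 2 * p y := by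
  have hnn : 0 ≤ fun y => (y - m) ^ 2 * p y := fun y => mul_nonneg (sq_nonneg _) (p0 y)
  refine lt_of_le_of_ne (integral_nonneg hnn) fun h => ?_
  have hz := (integral_eq_zero_iff_of_nonneg hnn hi).1 h.symm
  have hm : ∀ᵐ y : ℝ, y ≠ m := by simp [ae_iff]
  have : p =ᵐ[volume] 0 := by
    filter_upwards [hz, hm] with y hy hym
    have := mul_eq_zero.1 hy
    simpa [sub_ne_zero.2 hym] using this
  rw [integral_congr_ae this] at p1
  simp at p1

/-- Realizability: every finite pair `(α, σ) ∈ (0,∞)²` arises as an equilibrium of the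
`G`- and `H`-equations of the GCP system with `m = m_g` for some contamination fraction
`ε ∈ (0,1)`, ground truth `(m_g, V_g)`, and outlier density `p_o` with mean `m_o` and
variance `V_o`. -/
theorem gcp_equilibrium_realizable (α σ : ℝ) (hα : 0 < α) (hσ : 0 < σ) :
    ∃ (ε m_g V_g m_o V_o : ℝ) (p_o : ℝ → ℝ),
      0 < ε ∧ ε < 1 ∧ 0 < V_g ∧ 0 < V_o ∧
      (∀ y, 0 ≤ p_o y) ∧
      Integrable p_o ∧ (∫ y, p_o y) = 1 ∧
      Integrable (fun y => y * p_o y) ∧ (∫ y, y * p_o y) = m_o ∧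
      Integrable (fun y => (y - m_o) ^ 2 * p_o y) ∧
      (∫ y, (y - m_o) ^ 2 * p_o y) = V_o ∧
      Integrable (fun y => Real.log (1 + (y - m_g) ^ 2 / (2 * σ)) *
        ((1 - ε) * gaussianPDF m_g V_g y + ε * p_o y)) ∧
      Integrable (fun y => (α * (y - m_g) ^ 2 - σ) / (2 * σ + (y - m_g) ^ 2) *
        ((1 - ε) * gaussianPDF m_g V_g y + ε * p_o y)) ∧
      (∫ y, Real.log (1 + (y - m_g) ^ 2 / (2 * σ)) *
          ((1 - ε) * gaussianPDF m_g V_g y + ε * p_o y))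
        + digamma α - digamma (α + 1 / 2) = 0 ∧
      (∫ y, (α * (y - m_g) ^ 2 - σ) / (2 * σ + (y - m_g) ^ 2) *
          ((1 - ε) * gaussianPDF m_g V_g y + ε * p_o y)) = 0 := by
  have hne : ∀ y : ℝ, 0 < 1 + y ^ 2 / (2 * σ) := fun y => by positivity
  have c0 : Continuous fun y : ℝ => 1 + y ^ 2 / (2 * σ) := by fun_prop
  have ca : Continuous fun y : ℝ => (1 + y ^ 2 / (2 * σ))⁻¹ := c0.inv₀ fun y => (hne y).ne'
  have cb := c0.log fun y => (hne y).ne'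
  have hga := integrable_mul_gaussianPDF ca (C := 1) fun y => by
    rw [abs_of_pos (inv_pos.2 (hne y))]
    have h1 : (1 + y ^ 2 / (2 * σ))⁻¹ ≤ 1 := inv_le_one_of_one_le₀ (by
      have : 0 ≤ y ^ 2 / (2 * σ) := by positivity
      linarith)
    nlinarith [sq_nonneg y]
  have hgb := integrable_mul_gaussianPDF cb (C := 1 / (2 * σ)) fun y => by
    have h0 : 0 ≤ y ^ 2 / (2 * σ) := by positivity
    rw [abs_of_nonneg (Real.log_nonneg (by linarith))]
    have h1 := Real.log_le_sub_one_of_pos (hne y)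
    have h2 : 0 < 1 / (2 * σ) := by positivity
    calc Real.log (1 + y ^ 2 / (2 * σ)) ≤ y ^ 2 / (2 * σ) := by linarith
      _ = 1 / (2 * σ) * y ^ 2 := by ring
      _ ≤ 1 / (2 * σ) * (1 + y ^ 2) := by gcongr; linarith
  have hg : Integrable (gaussianPDF 0 1) := by
    simpa using integrable_mul_gaussianPDF (f := fun _ => 1) continuous_const (C := 1) fun y => by
      rw [abs_one]
      nlinarith [sq_nonneg y]
  set Ag := ∫ y, (1 + y ^ 2 / (2 * σ))⁻¹ * gaussianPDF 0 1 y with hAg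
  set Bg := ∫ y, Real.log (1 + y ^ 2 / (2 * σ)) * gaussianPDF 0 1 y with hBg
  set a := α / (α + 1 / 2) with ha
  set D := digamma (α + 1 / 2) - digamma α with hD
  have ha0 : 0 < a := by positivity
  have ha1 : a < 1 := by rw [ha, div_lt_one (by positivity)]; linarith
  have haD : -Real.log a < D := by
    have := log_sub_log_lt_digamma_sub hα
    rw [ha, Real.log_div hα.ne' (by positivity)]
    linarith
  obtain ⟨ε, hε0, hε1, hA0, hA1, hAB⟩ : ∃ ε : ℝ, 0 < ε ∧ ε < 1 ∧ 0 < (a - (1 - ε) * Ag) / ε ∧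
      (a - (1 - ε) * Ag) / ε < 1 ∧
      -Real.log ((a - (1 - ε) * Ag) / ε) < (D - (1 - ε) * Bg) / ε := by
    have t1 : ContinuousAt (fun ε : ℝ => (a - (1 - ε) * Ag) / ε) 1 :=
      ContinuousAt.div (by fun_prop) (by fun_prop) one_ne_zero
    have t2 : ContinuousAt (fun ε : ℝ => (D - (1 - ε) * Bg) / ε) 1 :=
      ContinuousAt.div (by fun_prop) (by fun_prop) one_ne_zero
    have t3 : ContinuousAt (fun ε : ℝ => -Real.log ((a - (1 - ε) * Ag) / ε)) 1 :=
      (t1.log (by simpa using ha0.ne')).neg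
    have e0 := (continuousAt_const (y := (0 : ℝ))).eventually_lt t1 (by simpa using ha0)
    have e1 := t1.eventually_lt (continuousAt_const (y := (1 : ℝ))) (by simpa using ha1)
    have e2 := t3.eventually_lt t2 (by simpa using haD)
    have e3 : ∀ᶠ ε : ℝ in nhds 1, 0 < ε := lt_mem_nhds one_pos
    obtain ⟨ε, ⟨h0, h1, h2, h3⟩, h4⟩ :=
      (((e0.and (e1.and (e2.and e3))).filter_mono nhdsWithin_le_nhds).and
        (self_mem_nhdsWithin (a := (1 : ℝ)) (s := Set.Iio 1))).exists
    exact ⟨ε, h3, h4, h0, h1, h2⟩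
  obtain ⟨p, p0, pi, p1, pm, pv, pa, hpA, pb, hpB⟩ := isMomentPair_of_neg_log_lt hσ hA0 hA1 hAB
  have hvar : ∀ m : ℝ, Integrable (fun y => (y - m) ^ 2 * p y) := by
    intro m
    have e : (fun y => (y - m) ^ 2 * p y) =
        fun y => y ^ 2 * p y - 2 * m * (y * p y) + m ^ 2 * p y := by
      ext y; ring
    rw [e]
    exact (pv.sub (pm.const_mul _)).add (pi.const_mul _)
  obtain ⟨hia, hIa⟩ := integral_mul_mix (1 - ε) ε hga pa
  obtain ⟨hib, hIb⟩ := integral_mul_mix (1 - ε) ε hgb pb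
  have hic : Integrable fun y => (1 - ε) * gaussianPDF 0 1 y + ε * p y :=
    (hg.const_mul _).add (pi.const_mul _)
  have hIc : (∫ y, (1 - ε) * gaussianPDF 0 1 y + ε * p y) = 1 := by
    rw [integral_add (hg.const_mul _) (pi.const_mul _), integral_const_mul, integral_const_mul,
      integral_gaussianPDF, p1]
    ring
  have hH : (fun y : ℝ => (α * (y - 0) ^ 2 - σ) / (2 * σ + (y - 0) ^ 2) *
        ((1 - ε) * gaussianPDF 0 1 y + ε * p y)) =
      fun y => α * ((1 - ε) * gaussianPDF 0 1 y + ε * p y) - (α + 1 / 2) *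
        ((1 + y ^ 2 / (2 * σ))⁻¹ * ((1 - ε) * gaussianPDF 0 1 y + ε * p y)) := by
    ext y
    have e : (α * (y - 0) ^ 2 - σ) / (2 * σ + (y - 0) ^ 2) =
        α - (α + 1 / 2) * (1 + y ^ 2 / (2 * σ))⁻¹ := by
      have := (hne y).ne'
      have h2 : 2 * σ + y ^ 2 ≠ 0 := by positivity
      have h3 : 1 + y ^ 2 / (2 * σ) = (2 * σ + y ^ 2) / (2 * σ) := by field_simp
      rw [sub_zero, h3, inv_div]
      field_simp
      ring
    rw [e]
    ring
  refine ⟨ε, 0, 1, ∫ y, y * p y, ∫ y, (y - ∫ x, x * p x) ^ 2 * p y, p, hε0, hε1, one_pos,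
    integral_sq_sub_mul_pos p0 p1 (hvar _), p0, pi, p1, pm, rfl, hvar _, rfl, ?_, ?_, ?_, ?_⟩
  · simpa only [sub_zero] using hib
  · rw [hH]
    exact (hic.const_mul _).sub (hia.const_mul _)
  · simp only [sub_zero]
    rw [hIb, hpB, ← hBg, mul_div_cancel₀ _ hε0.ne']
    linarith
  · rw [hH, integral_sub (hic.const_mul _) (hia.const_mul _), integral_const_mul,
      integral_const_mul, hIc, hIa, hpA, ← hAg, mul_div_cancel₀ _ hε0.ne', ha]
    field_simp
    ring
end
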